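/- arXiv:2002.00809 — 2 statements merged into one kernel-verified Lean document; each statement's English description precedes it below -/
import Mathlib

section
/- Let h(z) = ∏_{i=1}^{L} (z - a_i)^{-(n_i+1)} with distinct a_i, and suppose ∑_{i=1}^{L} n_i + t ≥ 1 for some integer t ≥ 0. Let s₁, ..., s_L, s be complex parameters with s ≠ 0 and s_i = 0 iff n_i = 0, chosen so that all denominators below are nonzero. Then for z not a pole of h, with Θ₂(r,p) = p^{(∑_m n_m)+t}/(p!(n_r-p)!) · (-1)^p · ∏_{m≠r} ∏_{q=1}^{n_m} 1/(q s_m (z-a_r) - p s_r (z-a_m)) and Θ₁(j,r,p) = (js - p s_r)^{(∑_m n_m)+L-1+t}/(p!(n_r-p)!) · (-1)^p · ∏_{m≠r} ∏_{q=0}^{n_m} 1/((z-a_m)(js - p s_r) - (z-a_r)(js - q s_m)), the t-th derivative of h satisfies h^{(t)}(z) = (1/s^t) (∏_m 1/(z-a_m)) (-1)^{(∑_m n_m)+t} ∑_{r: n_r ≥ 1} s_r^{(∑_{m≠r} n_m)+t} (z-a_r)^{-(n_r+t)} ∑_{p=1}^{n_r} Θ₂(r,p) + (t!/s^t) ∑_{j=1}^{t}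 ((-1)^j/(j!(t-j)!)) ∑_{r=1}^{L} (1/(s_r^{n_r}(z-a_r)^{n_r+1+t})) ∑_{p=0}^{n_r} Θ₁(j,r,p). -/
noncomputable def hcs {ι : Type*} (S : Finset ι) (c : ι → ℂ) (t : ℕ) : ℂ :=
  PowerSeries.coeff t (∏ i ∈ S, PowerSeries.mk (fun k => c i ^ k))

lemma hcs_empty {ι : Type*} (c : ι → ℂ) (t : ℕ) : hcs ∅ c (t + 1) = 0 := by
  simp [hcs, PowerSeries.coeff_one]

lemma hcs_zero {ι : Type*} (S : Finset ι) (c : ι → ℂ) : hcs S c 0 = 1 := by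
  simp [hcs, PowerSeries.coeff_zero_eq_constantCoeff, map_prod,
    ← PowerSeries.coeff_zero_eq_constantCoeff_apply]

lemma geo_rec (c : ℂ) : (PowerSeries.mk (fun k => c ^ k) : PowerSeries ℂ) =
    1 + PowerSeries.X * (PowerSeries.C c * PowerSeries.mk (fun k => c ^ k)) := by
  ext k
  cases k with
  | zero => simp
  | succ k => simp [PowerSeries.coeff_succ_X_mul, PowerSeries.coeff_one, pow_succ']

lemma hcs_insert {ι : Type*} [DecidableEq ι] (S : Finset ι) (c : ι → ℂ) (t : ℕ) (i : ι)
    (hi : i ∉ S) :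
    hcs (insert i S) c (t + 1) = hcs S c (t + 1) + c i * hcs (insert i S) c t := by
  unfold hcs
  rw [Finset.prod_insert hi]
  conv_lhs => rw [geo_rec]
  rw [add_mul, one_mul, map_add, mul_assoc, PowerSeries.coeff_succ_X_mul, mul_assoc,
    PowerSeries.coeff_C_mul]

lemma hcs_congr {ι : Type*} (S : Finset ι) (c d : ι → ℂ) (t : ℕ) (h : ∀ i ∈ S, c i = d i) :
    hcs S c t = hcs S d t := by
  unfold hcs
  rw [Finset.prod_congr rfl]
  intro i hi
  rw [h i hi]

lemma hcs_subset {ι : Type*} (S T : Finset ι) (c : ι → ℂ) (t : ℕ) (hST : S ⊆ T)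
    (h : ∀ i ∈ T, i ∉ S → c i = 0) : hcs T c t = hcs S c t := by
  unfold hcs
  congr 1
  symm
  apply Finset.prod_subset hST
  intro i hi hi'
  rw [h i hi hi']
  ext k
  cases k <;> simp [PowerSeries.coeff_one]

lemma hcs_divdiff {ι : Type*} [DecidableEq ι] (S : Finset ι) (c : ι → ℂ) :
    ∀ t : ℕ, Set.InjOn c S → 1 ≤ S.card + t →
    hcs S c t = ∑ i ∈ S, c i ^ (S.card + t - 1) * (∏ k ∈ S.erase i, (c i - c k))⁻¹ := by
  induction S using Finset.induction_on with
  | empty =>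
    intro t _ ht
    cases t with
    | zero => simp at ht
    | succ t => simp [hcs_empty]
  | insert a S ha ih =>
    intro t hinj ht
    induction t with
    | zero =>
      rw [hcs_zero]
      have := Lagrange.coeff_eq_sum (s := insert a S) (v := c) hinj
        (P := Polynomial.X ^ ((insert a S).card - 1)) (by
          rw [Polynomial.degree_X_pow]
          norm_cast
          rw [Finset.card_insert_of_notMem ha]; simp)
      simp only [Polynomial.coeff_X_pow, if_true, Polynomial.eval_pow, Polynomial.eval_X] at this
      rw [this]
      simp [div_eq_mul_inv]
    | succ t iht =>
      have hc : (insert a S).card = S.card + 1 := Finset.card_insert_of_notMem ha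
      rw [hcs_insert _ _ _ _ ha, ih (t+1) (hinj.mono (by simp)) (by omega),
        iht (by omega), hc, Finset.mul_sum, Finset.sum_insert ha, Finset.sum_insert ha]
      have e1 : S.card + 1 + (t + 1) - 1 = S.card + t + 1 := by omega
      have e2 : S.card + 1 + t - 1 = S.card + t := by omega
      have e3 : S.card + (t + 1) - 1 = S.card + t := by omega
      rw [e1, e2, e3, add_left_comm, ← Finset.sum_add_distrib]
      congr 1
      · ring
      · apply Finset.sum_congr rfl
        intro i hi
        have hia : i ≠ a := fun h => ha (h ▸ hi)
        have hne : c i - c a ≠ 0 := sub_ne_zero.2 fun h =>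
          hia (hinj (by simp [hi]) (by simp) h)
        rw [Finset.erase_insert_of_ne hia.symm, Finset.prod_insert (by simp [ha]), mul_inv]
        field_simp
        ring

open Polynomial in
lemma hcs_poly {ι : Type*} [DecidableEq ι] (S : Finset ι) (A B : ι → ℂ) :
    ∀ t : ℕ, ∃ P : ℂ[X], P.natDegree ≤ t ∧ P.coeff t = hcs S A t ∧
      ∀ y, P.eval y = hcs S (fun i => y * A i + B i) t := by
  induction S using Finset.induction_on with
  | empty =>
    intro t
    cases t with
    | zero => exact ⟨1, by simp, by simp [hcs_zero], by simp [hcs_zero]⟩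
    | succ t => exact ⟨0, by simp, by simp [hcs_empty], by simp [hcs_empty]⟩
  | insert a S ha ih =>
    intro t
    induction t with
    | zero => exact ⟨1, by simp, by simp [hcs_zero], by simp [hcs_zero]⟩
    | succ t iht =>
      obtain ⟨P, hP1, hP2, hP3⟩ := ih (t+1)
      obtain ⟨Q, hQ1, hQ2, hQ3⟩ := iht
      have hQ0 : Q.coeff (t+1) = 0 := coeff_eq_zero_of_natDegree_lt (by omega)
      refine ⟨P + (C (A a) * X + C (B a)) * Q, ?_, ?_, ?_⟩
      · apply natDegree_add_le_of_degree_le hP1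
        rw [add_comm t 1]
        exact natDegree_mul_le_of_le (by compute_degree) hQ1
      · rw [hcs_insert _ _ _ _ ha, coeff_add, hP2, add_mul, coeff_add, mul_assoc, coeff_C_mul,
          coeff_X_mul, coeff_C_mul, hQ0, hQ2]
        ring
      · intro y
        rw [hcs_insert _ _ _ _ ha]
        simp only [eval_add, eval_mul, eval_C, eval_X, hP3, hQ3]
        ring

open Polynomial in
lemma fd_poly (P : ℂ[X]) (t : ℕ) (h : P.natDegree ≤ t) :
    ∑ j ∈ Finset.range (t + 1), (-1 : ℂ) ^ j * (t.choose j : ℂ) * P.eval (j : ℂ) =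
      (-1) ^ t * (t.factorial : ℂ) * P.coeff t := by
  have h2 : (fwdDiff (1:ℂ))^[t] P.eval 0 = P.coeff t * (t.factorial : ℂ) := by
    rcases h.lt_or_eq with h | h
    · rw [Polynomial.fwdDiff_iter_eq_zero_of_degree_lt h, coeff_eq_zero_of_natDegree_lt h]
      simp
    · have := congrFun (Polynomial.fwdDiff_iter_degree_eq_factorial P) 0
      rw [h] at this
      rw [this]
      simp [leadingCoeff, h]
  rw [mul_assoc, mul_comm (t.factorial : ℂ), ← h2, fwdDiff_iter_eq_sum_shift, Finset.mul_sum]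
  apply Finset.sum_congr rfl
  intro j hj
  have hj' : j ≤ t := by simpa [Nat.lt_succ_iff] using hj
  obtain ⟨k, rfl⟩ := Nat.exists_eq_add_of_le hj'
  simp only [zsmul_eq_mul, nsmul_eq_mul, zero_add, mul_one, Nat.add_sub_cancel_left]
  push_cast
  have : (-1 : ℂ) ^ (j + k) * (-1) ^ k = (-1) ^ j := by
    rw [pow_add, mul_assoc, ← mul_pow]; simp
  rw [← this]; ring

lemma leib (g : ℂ → ℂ) (b x : ℂ) (t : ℕ) (hg : AnalyticAt ℂ g x) :
    iteratedDeriv (t + 1) (fun w => (w - b) * g w) x =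
      (x - b) * iteratedDeriv (t + 1) g x + (t + 1) * iteratedDeriv t g x := by
  have := iteratedDeriv_mul (n := t + 1) (f := fun w : ℂ => w - b) (g := g) (x := x)
    (by fun_prop) hg.contDiffAt
  change iteratedDeriv (t + 1) ((fun w => w - b) * g) x = _
  rw [this, Finset.sum_range_succ', Finset.sum_range_succ', Finset.sum_eq_zero]
  · simp [iteratedDeriv_succ]
    ring
  · intro i hi
    have h1 : deriv (fun w : ℂ => w - b) = fun _ => 1 := by ext; simp
    rw [iteratedDeriv_succ', h1, iteratedDeriv_succ']
    simp

lemma an_prod {ι : Type*} (S : Finset ι) (b : ι → ℂ) (x : ℂ) (hx : ∀ i ∈ S, x ≠ b i) :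
    AnalyticAt ℂ (fun w => ∏ i ∈ S, (w - b i)⁻¹) x := by
  apply Finset.analyticAt_fun_prod
  intro i hi
  exact AnalyticAt.inv (by fun_prop) (sub_ne_zero.2 (hx i hi))

lemma iter_prod {ι : Type*} [DecidableEq ι] (S : Finset ι) (b : ι → ℂ) (x : ℂ) :
    ∀ t : ℕ, (∀ i ∈ S, x ≠ b i) →
    iteratedDeriv t (fun w => ∏ i ∈ S, (w - b i)⁻¹) x =
      (-1) ^ t * (t.factorial : ℂ) * (∏ i ∈ S, (x - b i)⁻¹) * hcs S (fun i => (x - b i)⁻¹) t := by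
  induction S using Finset.induction_on with
  | empty =>
    intro t _
    cases t with
    | zero => simp [hcs_zero]
    | succ t => simp [hcs_empty, iteratedDeriv_const]
  | insert a S ha ih =>
    intro t hx
    induction t with
    | zero => simp [hcs_zero]
    | succ t iht =>
      have hxa : x - b a ≠ 0 := sub_ne_zero.2 (hx a (by simp))
      have hxS : ∀ i ∈ S, x ≠ b i := fun i hi => hx i (by simp [hi])
      have h1 := leib _ (b a) x t (an_prod (insert a S) b x hx)
      have h2 : (fun w => (w - b a) * ∏ i ∈ insert a S, (w - b i)⁻¹) =ᶠ[nhds x]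
          (fun w => ∏ i ∈ S, (w - b i)⁻¹) := by
        filter_upwards [isOpen_ne.mem_nhds (hx a (by simp))] with w hw
        rw [Finset.prod_insert ha, mul_inv_cancel_left₀ (sub_ne_zero.2 hw)]
      rw [h2.iteratedDeriv_eq, ih (t+1) hxS, iht] at h1
      have h3 : iteratedDeriv (t+1) (fun w => ∏ i ∈ insert a S, (w - b i)⁻¹) x = 
          (x - b a)⁻¹ * ((x - b a) * iteratedDeriv (t+1) (fun w => ∏ i ∈ insert a S, (w - b i)⁻¹) x) := by
        rw [inv_mul_cancel_left₀ hxa]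
      rw [h3, ← sub_eq_of_eq_add h1, hcs_insert _ _ _ _ ha, Finset.prod_insert ha, Nat.factorial_succ]
      push_cast
      ring

lemma prod_fact (p n : ℕ) (h : p ≤ n) :
    ∏ q ∈ (Finset.range (n + 1)).erase p, ((q : ℂ) - p) =
      (-1) ^ p * ((p.factorial : ℂ) * ((n - p).factorial : ℂ)) := by
  induction n, h using Nat.le_induction with
  | base =>
    have : (Finset.range (p + 1)).erase p = Finset.range p := by
      ext q; simp; omega
    rw [this, ← Finset.prod_range_reflect, ← Finset.prod_range_add_one_eq_factorial]
    push_cast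
    rw [Nat.sub_self, Nat.factorial_zero, Nat.cast_one, mul_one]
    conv_rhs => rw [← Finset.card_range p, ← Finset.prod_const, Finset.card_range, ← Finset.prod_mul_distrib]
    apply Finset.prod_congr rfl
    intro q hq
    have hq' : q < p := by simpa using hq
    rw [Nat.sub_sub, Nat.cast_sub (by omega)]
    push_cast; ring
  | succ n hn ih =>
    have : (Finset.range (n + 1 + 1)).erase p = insert (n + 1) ((Finset.range (n + 1)).erase p) := by
      ext q; simp; omega
    rw [this, Finset.prod_insert (by simp), ih, Nat.succ_sub hn, Nat.factorial_succ]
    push_cast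
    rw [Nat.cast_sub hn]
    ring

lemma prod_fact' (p n : ℕ) (h1 : 1 ≤ p) (h : p ≤ n) :
    (-(p : ℂ)) * ∏ q ∈ (Finset.Icc 1 n).erase p, ((q : ℂ) - p) =
      (-1) ^ p * ((p.factorial : ℂ) * ((n - p).factorial : ℂ)) := by
  rw [← prod_fact p n h]
  have : (Finset.range (n + 1)).erase p = insert 0 ((Finset.Icc 1 n).erase p) := by
    ext q; simp; omega
  rw [this, Finset.prod_insert (by simp)]
  simp

lemma prod_erase_sigma {L : ℕ} (T : Fin L → Finset ℕ) (F : (Σ _ : Fin L, ℕ) → ℂ) (r : Fin L)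
    (p : ℕ) :
    ∏ k ∈ (Finset.univ.sigma T).erase ⟨r, p⟩, F k =
      (∏ m ∈ Finset.univ.erase r, ∏ q ∈ T m, F ⟨m, q⟩) * ∏ q ∈ (T r).erase p, F ⟨r, q⟩ := by
  have : (Finset.univ.sigma T).erase ⟨r, p⟩ =
      Finset.univ.sigma (fun m => if m = r then (T r).erase p else T m) := by
    ext ⟨m, q⟩
    by_cases hm : m = r
    · subst hm; simp
    · simp [hm]
  rw [this, Finset.prod_sigma, ← Finset.mul_prod_erase Finset.univ _ (Finset.mem_univ r), mul_comm]
  congr 1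
  · apply Finset.prod_congr rfl
    intro m hm
    rw [if_neg (Finset.ne_of_mem_erase hm)]
  · simp

lemma term1 {L : ℕ} (n : Fin L → ℕ) (x σ : Fin L → ℂ) (y : ℂ) (hx : ∀ i, x i ≠ 0)
    (hσ : ∀ i, σ i = 0 ↔ n i = 0) (r : Fin L) (p t : ℕ) (hp : p ≤ n r) (hL : 1 ≤ L)
    (c : (Σ _ : Fin L, ℕ) → ℂ) (hc : c = fun k => (y - (k.2 : ℂ) * σ k.1) / x k.1) :
    (∏ i, (x i ^ (n i + 1))⁻¹) * (c ⟨r, p⟩ ^ ((∑ m, n m) + L - 1 + t) *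
      (∏ k ∈ (Finset.univ.sigma fun m => Finset.range (n m + 1)).erase ⟨r, p⟩,
        (c ⟨r, p⟩ - c k))⁻¹) =
    (σ r ^ n r * x r ^ (n r + 1 + t))⁻¹ * 
      ((y - (p : ℂ) * σ r) ^ ((∑ m, n m) + L - 1 + t) /
          ((p.factorial : ℂ) * ((n r - p).factorial : ℂ)) * (-1) ^ p *
        ∏ m ∈ Finset.univ.erase r, ∏ q ∈ Finset.range (n m + 1),
          (x m * (y - (p : ℂ) * σ r) - x r * (y - (q : ℂ) * σ m))⁻¹) := by
  have hxr := hx r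
  have hσr : σ r ^ n r ≠ 0 := by
    by_cases h : n r = 0
    · simp [h]
    · exact pow_ne_zero _ fun h' => h ((hσ r).1 h')
  have hM : (∑ m, n m) + L - 1 + t = (∑ m ∈ Finset.univ.erase r, (n m + 1)) + n r + t := by
    have h1 : ∑ m, (n m + 1) = (∑ m, n m) + L := by simp [Finset.sum_add_distrib]
    have h2 := Finset.add_sum_erase Finset.univ (fun m => n m + 1) (Finset.mem_univ r)
    omega
  have hh : (∏ i, (x i ^ (n i + 1))⁻¹) =
      (x r ^ (n r + 1))⁻¹ * (∏ m ∈ Finset.univ.erase r, x m ^ (n m + 1))⁻¹ := by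
    rw [← Finset.mul_prod_erase Finset.univ _ (Finset.mem_univ r), Finset.prod_inv_distrib]
  have hsame : ∏ q ∈ (Finset.range (n r + 1)).erase p, (c ⟨r, p⟩ - c ⟨r, q⟩) =
      (σ r / x r) ^ n r * ((-1) ^ p * ((p.factorial : ℂ) * ((n r - p).factorial : ℂ))) := by
    rw [← prod_fact p _ hp]
    have hcard : ((Finset.range (n r + 1)).erase p).card = n r := by
      rw [Finset.card_erase_of_mem (by simp; omega)]; simp
    conv_rhs => rw [← hcard, ← Finset.prod_const, hcard, ← Finset.prod_mul_distrib]
    apply Finset.prod_congr rfl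
    intro q _
    rw [hc]; ring
  have hother : (∏ m ∈ Finset.univ.erase r, ∏ q ∈ Finset.range (n m + 1),
      (c ⟨r, p⟩ - c ⟨m, q⟩))⁻¹ =
      x r ^ (∑ m ∈ Finset.univ.erase r, (n m + 1)) * (∏ m ∈ Finset.univ.erase r, x m ^ (n m + 1)) *
      ∏ m ∈ Finset.univ.erase r, ∏ q ∈ Finset.range (n m + 1),
          (x m * (y - (p : ℂ) * σ r) - x r * (y - (q : ℂ) * σ m))⁻¹ := by
    rw [← Finset.prod_pow_eq_pow_sum, ← Finset.prod_mul_distrib, ← Finset.prod_mul_distrib,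
      ← Finset.prod_inv_distrib]
    apply Finset.prod_congr rfl
    intro m _
    have hxm := hx m
    rw [← mul_pow]
    conv_rhs => rw [← Finset.card_range (n m + 1), ← Finset.prod_const, Finset.card_range]
    rw [← Finset.prod_mul_distrib, ← Finset.prod_inv_distrib]
    apply Finset.prod_congr rfl
    intro q _
    have : c ⟨r, p⟩ - c ⟨m, q⟩ =
        (x r * x m)⁻¹ * (x m * (y - (p : ℂ) * σ r) - x r * (y - (q : ℂ) * σ m)) := by
      rw [hc]; field_simp
    rw [this, mul_inv, inv_inv]
  rw [prod_erase_sigma, mul_inv, hother, hsame, hh, hM]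
  have hW : (∏ m ∈ Finset.univ.erase r, x m ^ (n m + 1)) ≠ 0 :=
    Finset.prod_ne_zero_iff.2 fun m _ => pow_ne_zero _ (hx m)
  generalize (∏ m ∈ Finset.univ.erase r, x m ^ (n m + 1)) = W at *
  generalize (∏ m ∈ Finset.univ.erase r, ∏ q ∈ Finset.range (n m + 1),
          (x m * (y - (p : ℂ) * σ r) - x r * (y - (q : ℂ) * σ m))⁻¹) = D
  generalize (∑ m ∈ Finset.univ.erase r, (n m + 1)) = K
  have hf1 : (p.factorial : ℂ) ≠ 0 := by exact_mod_cast p.factorial_ne_zero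
  have hf2 : ((n r - p).factorial : ℂ) ≠ 0 := by exact_mod_cast (n r - p).factorial_ne_zero
  have hs : ((-1 : ℂ) ^ p)⁻¹ = (-1) ^ p := by rw [← inv_pow]; norm_num
  rw [mul_inv, mul_inv ((-1 : ℂ) ^ p), hs]
  have hcv : c ⟨r, p⟩ = (y - (p : ℂ) * σ r) / x r := by rw [hc]
  rw [hcv, div_pow, div_pow]
  generalize (y - (p : ℂ) * σ r) = Y
  generalize (-1 : ℂ) ^ p = e
  simp only [pow_add, pow_one]
  field_simp

lemma term2 {L : ℕ} (n : Fin L → ℕ) (x σ : Fin L → ℂ) (hx : ∀ i, x i ≠ 0)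
    (hσ : ∀ i, σ i = 0 ↔ n i = 0) (r : Fin L) (p t : ℕ) (hp1 : 1 ≤ p) (hp : p ≤ n r)
    (c : (Σ _ : Fin L, ℕ) → ℂ) (hc : c = fun k => (- ((k.2 : ℂ) * σ k.1)) / x k.1) :
    (∏ i, (x i ^ (n i + 1))⁻¹) * (c ⟨r, p⟩ ^ ((∑ m, n m) + t - 1) *
      (∏ k ∈ (Finset.univ.sigma fun m => Finset.Icc 1 (n m)).erase ⟨r, p⟩,
        (c ⟨r, p⟩ - c k))⁻¹) =
    (∏ m, (x m)⁻¹) * (-1) ^ ((∑ m, n m) + t) *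
      (σ r ^ ((∑ m ∈ Finset.univ.erase r, n m) + t) * (x r ^ (n r + t))⁻¹ *
        ((p : ℂ) ^ ((∑ m, n m) + t) /
          ((p.factorial : ℂ) * ((n r - p).factorial : ℂ)) * (-1) ^ p *
        ∏ m ∈ Finset.univ.erase r, ∏ q ∈ Finset.Icc 1 (n m),
          ((q : ℂ) * σ m * x r - (p : ℂ) * σ r * x m)⁻¹)) := by
  have hxr := hx r
  have hσr : σ r ≠ 0 := fun h' => by have := (hσ r).1 h'; omega
  obtain ⟨k, hk⟩ : ∃ k, n r = k + 1 := ⟨n r - 1, by omega⟩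
  have hN : (∑ m, n m) = (∑ m ∈ Finset.univ.erase r, n m) + (k + 1) := by
    have h2 := Finset.add_sum_erase Finset.univ (fun m => n m) (Finset.mem_univ r)
    omega
  have hM : (∑ m, n m) + t - 1 = (∑ m ∈ Finset.univ.erase r, n m) + k + t := by omega
  have hh : (∏ i, (x i ^ (n i + 1))⁻¹) = (∏ m, (x m)⁻¹) *
      ((x r ^ (n r))⁻¹ * (∏ m ∈ Finset.univ.erase r, x m ^ (n m))⁻¹) := by
    rw [← Finset.prod_inv_distrib, Finset.mul_prod_erase Finset.univ (fun m => (x m ^ n m)⁻¹) (Finset.mem_univ r),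
      ← Finset.prod_mul_distrib]
    apply Finset.prod_congr rfl
    intro i _
    rw [pow_succ, mul_inv, mul_comm]
  have hsame : ∏ q ∈ (Finset.Icc 1 (n r)).erase p, (c ⟨r, p⟩ - c ⟨r, q⟩) =
      (σ r / x r) ^ k * (((-1) ^ p * ((p.factorial : ℂ) * ((n r - p).factorial : ℂ))) / (-(p : ℂ))) := by
    have hp0 : -(p : ℂ) ≠ 0 := neg_ne_zero.2 (by exact_mod_cast (by omega : p ≠ 0))
    rw [← prod_fact' p _ hp1 hp, mul_div_cancel_left₀ _ hp0]
    have hcard : ((Finset.Icc 1 (n r)).erase p).card = k := by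
      rw [Finset.card_erase_of_mem (by simp; omega)]; simp [hk]
    conv_rhs => rw [← hcard, ← Finset.prod_const, ← Finset.prod_mul_distrib]
    apply Finset.prod_congr rfl
    intro q _
    rw [hc]; ring
  have hother : (∏ m ∈ Finset.univ.erase r, ∏ q ∈ Finset.Icc 1 (n m),
      (c ⟨r, p⟩ - c ⟨m, q⟩))⁻¹ =
      x r ^ (∑ m ∈ Finset.univ.erase r, n m) * (∏ m ∈ Finset.univ.erase r, x m ^ (n m)) *
      ∏ m ∈ Finset.univ.erase r, ∏ q ∈ Finset.Icc 1 (n m),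
          ((q : ℂ) * σ m * x r - (p : ℂ) * σ r * x m)⁻¹ := by
    rw [← Finset.prod_pow_eq_pow_sum, ← Finset.prod_mul_distrib, ← Finset.prod_mul_distrib,
      ← Finset.prod_inv_distrib]
    apply Finset.prod_congr rfl
    intro m _
    have hxm := hx m
    rw [← mul_pow]
    have hcard : (Finset.Icc 1 (n m)).card = n m := by simp
    have hpw : (x r * x m) ^ n m = ∏ q ∈ Finset.Icc 1 (n m), (x r * x m) := by
      rw [Finset.prod_const, hcard]
    rw [hpw, ← Finset.prod_mul_distrib, ← Finset.prod_inv_distrib]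
    apply Finset.prod_congr rfl
    intro q _
    have : c ⟨r, p⟩ - c ⟨m, q⟩ =
        (x r * x m)⁻¹ * ((q : ℂ) * σ m * x r - (p : ℂ) * σ r * x m) := by
      rw [hc]; field_simp; ring
    rw [this, mul_inv, inv_inv]
  rw [prod_erase_sigma, mul_inv, hother, hsame, hh, hM, hN]
  have hW : (∏ m ∈ Finset.univ.erase r, x m ^ (n m)) ≠ 0 :=
    Finset.prod_ne_zero_iff.2 fun m _ => pow_ne_zero _ (hx m)
  generalize (∏ m ∈ Finset.univ.erase r, x m ^ (n m)) = W at *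
  generalize (∏ m ∈ Finset.univ.erase r, ∏ q ∈ Finset.Icc 1 (n m),
          ((q : ℂ) * σ m * x r - (p : ℂ) * σ r * x m)⁻¹) = D
  generalize (∑ m ∈ Finset.univ.erase r, n m) = K
  have hf1 : (p.factorial : ℂ) ≠ 0 := by exact_mod_cast p.factorial_ne_zero
  have hp0 : (p : ℂ) ≠ 0 := by exact_mod_cast (by omega : p ≠ 0)
  have hf2 : ((n r - p).factorial : ℂ) ≠ 0 := by exact_mod_cast (n r - p).factorial_ne_zero
  have hs : ((-1 : ℂ) ^ p)⁻¹ = (-1) ^ p := by rw [← inv_pow]; norm_num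
  rw [mul_inv, mul_div_assoc, mul_inv ((-1 : ℂ) ^ p), hs]
  have hcv : c ⟨r, p⟩ = (-1) * (p * σ r / x r) := by rw [hc]; ring
  rw [hcv, mul_pow, div_pow, div_pow, mul_pow]
  generalize ((n r - p).factorial : ℂ) = f2 at *
  rw [hk]
  generalize (-1 : ℂ) ^ p = e
  have e1 : (-1 : ℂ) ^ (K + (k + 1) + t) = - (-1) ^ (K + k + t) := by ring
  rw [e1]
  generalize (-1 : ℂ) ^ (K + k + t) = e'
  simp only [pow_add, pow_one]
  field_simp

/-- Formula (7) of Theorem 3.1: explicit formula for the `t`-th derivative of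
`h(z) = ∏ (z - aᵢ)^{-(nᵢ+1)}` when `(∑ nᵢ) + t ≥ 1`, for any choice of
nonzero-denominator parameters `s`, `σᵢ` with `s ≠ 0` and `σᵢ = 0 ↔ nᵢ = 0`. -/
theorem stmt_15 (L : ℕ) (hL : 1 ≤ L) (a : Fin L → ℂ) (ha : Function.Injective a)
    (n : Fin L → ℕ) (t : ℕ) (hnt : 1 ≤ (∑ m, n m) + t)
    (σ : Fin L → ℂ) (s : ℂ) (hs : s ≠ 0) (hσ : ∀ i, σ i = 0 ↔ n i = 0)
    (z : ℂ) (hz : ∀ i, z ≠ a i)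
    (hden₁ : ∀ j ∈ Finset.Icc 1 t, ∀ r : Fin L, ∀ p ≤ n r, ∀ m : Fin L, m ≠ r → ∀ q ≤ n m,
      (z - a m) * ((j : ℂ) * s - (p : ℂ) * σ r) -
        (z - a r) * ((j : ℂ) * s - (q : ℂ) * σ m) ≠ 0)
    (hden₂ : ∀ r : Fin L, 1 ≤ n r → ∀ p ∈ Finset.Icc 1 (n r), ∀ m : Fin L, m ≠ r →
      ∀ q ∈ Finset.Icc 1 (n m),
      (q : ℂ) * σ m * (z - a r) - (p : ℂ) * σ r * (z - a m) ≠ 0) :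
    iteratedDeriv t (fun w : ℂ => ∏ i, ((w - a i) ^ (n i + 1))⁻¹) z =
      1 / s ^ t * (∏ m, (z - a m)⁻¹) * (-1) ^ ((∑ m, n m) + t) *
        (∑ r ∈ Finset.univ.filter (fun r : Fin L => 1 ≤ n r),
          σ r ^ ((∑ m ∈ Finset.univ.erase r, n m) + t) * ((z - a r) ^ (n r + t))⁻¹ *
            ∑ p ∈ Finset.Icc 1 (n r),
              (p : ℂ) ^ ((∑ m, n m) + t) /
                  ((p.factorial : ℂ) * ((n r - p).factorial : ℂ)) * (-1) ^ p *
                ∏ m ∈ Finset.univ.erase r, ∏ q ∈ Finset.Icc 1 (n m),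
                  ((q : ℂ) * σ m * (z - a r) - (p : ℂ) * σ r * (z - a m))⁻¹) +
      (t.factorial : ℂ) / s ^ t *
        ∑ j ∈ Finset.Icc 1 t,
          (-1 : ℂ) ^ j / ((j.factorial : ℂ) * ((t - j).factorial : ℂ)) *
            ∑ r : Fin L,
              (σ r ^ n r * (z - a r) ^ (n r + 1 + t))⁻¹ *
                ∑ p ∈ Finset.range (n r + 1),
                  ((j : ℂ) * s - (p : ℂ) * σ r) ^ ((∑ m, n m) + L - 1 + t) /
                      ((p.factorial : ℂ) * ((n r - p).factorial : ℂ)) * (-1) ^ p *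
                    ∏ m ∈ Finset.univ.erase r, ∏ q ∈ Finset.range (n m + 1),
                      ((z - a m) * ((j : ℂ) * s - (p : ℂ) * σ r) -
                        (z - a r) * ((j : ℂ) * s - (q : ℂ) * σ m))⁻¹ := by
  have hx : ∀ i, z - a i ≠ 0 := fun i => sub_ne_zero.2 (hz i)
  set S : Finset (Σ _ : Fin L, ℕ) := Finset.univ.sigma fun m => Finset.range (n m + 1) with hS
  set S' : Finset (Σ _ : Fin L, ℕ) := Finset.univ.sigma fun m => Finset.Icc 1 (n m) with hS'
  have hcardS : S.card = (∑ m, n m) + L := by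
    simp [hS, Finset.card_sigma, Finset.sum_add_distrib]
  have hcardS' : S'.card = ∑ m, n m := by
    simp [hS', Finset.card_sigma]
  have hprod : ∀ w : ℂ, ∏ i, ((w - a i) ^ (n i + 1))⁻¹ = ∏ k ∈ S, (w - a k.1)⁻¹ := by
    intro w
    rw [hS, Finset.prod_sigma]
    apply Finset.prod_congr rfl
    intro i _
    simp [inv_pow]
  -- the derivative
  have hder := iter_prod S (fun k => a k.1) z t (fun k _ => hz k.1)
  rw [← hprod z] at hder
  have hfun : (fun w : ℂ => ∏ i, ((w - a i) ^ (n i + 1))⁻¹) =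
      fun w => ∏ k ∈ S, (w - a k.1)⁻¹ := funext hprod
  rw [hfun, hder]
  -- the polynomial
  obtain ⟨P, hP1, hP2, hP3⟩ := hcs_poly S (fun k => (z - a k.1)⁻¹)
    (fun k => - ((k.2 : ℂ) * σ k.1) / (z - a k.1)) t
  have hfd := fd_poly (P.comp (Polynomial.C s * Polynomial.X)) t (by
    refine Polynomial.natDegree_comp_le.trans ?_
    calc P.natDegree * (Polynomial.C s * Polynomial.X).natDegree ≤ P.natDegree * 1 :=
          Nat.mul_le_mul_left _ (by compute_degree)
      _ ≤ t := by omega)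
  rw [Polynomial.comp_C_mul_X_coeff, hP2] at hfd
  simp only [Polynomial.eval_comp, Polynomial.eval_mul, Polynomial.eval_C, Polynomial.eval_X,
    hP3] at hfd
  have hmul : (-1) ^ t * (t.factorial : ℂ) * (∏ i, ((z - a i) ^ (n i + 1))⁻¹) *
      hcs S (fun k => (z - a k.1)⁻¹) t = 1 / s ^ t * ((∏ i, ((z - a i) ^ (n i + 1))⁻¹) *
        ((-1) ^ t * (t.factorial : ℂ) * (hcs S (fun k => (z - a k.1)⁻¹) t * s ^ t))) := by
    field_simp
  rw [hmul, ← hfd, Finset.sum_range_succ', add_comm, mul_add, mul_add]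
  have hinj1 : ∀ (r : Fin L) (p q : ℕ) (y : ℂ), p ≤ n r → q ≤ n r →
      (y - (p : ℂ) * σ r) / (z - a r) = (y - (q : ℂ) * σ r) / (z - a r) → p = q := by
    intro r p q y hp hq h
    by_cases h0 : n r = 0
    · omega
    have hσr : σ r ≠ 0 := fun h' => h0 ((hσ r).1 h')
    rw [div_left_inj' (hx r)] at h
    have h' : (p : ℂ) * σ r = q * σ r := by linear_combination -h
    exact_mod_cast mul_right_cancel₀ hσr h'
  congr 1
  · -- the term j = 0
    rw [mul_assoc (1 / s ^ t), mul_assoc (1 / s ^ t)]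
    congr 1
    have hz0 : hcs S (fun k => s * ((0 : ℕ) : ℂ) * (z - a k.1)⁻¹ +
        - ((k.2 : ℂ) * σ k.1) / (z - a k.1)) t =
        hcs S' (fun k => - ((k.2 : ℂ) * σ k.1) / (z - a k.1)) t := by
      rw [hcs_congr S _ (fun k => - ((k.2 : ℂ) * σ k.1) / (z - a k.1)) t (by intro k _; simp)]
      apply hcs_subset
      · intro ⟨m, q⟩ hk
        simp [hS, hS'] at hk ⊢
        omega
      · intro ⟨m, q⟩ hk hk'
        simp [hS, hS'] at hk hk'
        have : q = 0 := by omega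
        simp [this]
    rw [hz0, hcs_divdiff S' _ t ?_ (by omega), hcardS']
    · rw [pow_zero, Nat.choose_zero_right, Nat.cast_one, one_mul, one_mul, Finset.mul_sum,
        Finset.sum_sigma, Finset.mul_sum, Finset.sum_filter]
      apply Finset.sum_congr rfl
      intro r _
      split_ifs with hr
      · rw [Finset.mul_sum, Finset.mul_sum]
        apply Finset.sum_congr rfl
        intro p hp
        rw [Finset.mem_Icc] at hp
        exact term2 n (fun i => z - a i) σ hx hσ r p t hp.1 hp.2 _ rfl
      · have : n r = 0 := by omega
        simp [this]
    · rintro ⟨r, p⟩ hk ⟨m, q⟩ hk' heq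
      simp [hS'] at hk hk'
      simp only at heq
      by_cases hmr : m = r
      · subst hmr
        have := hinj1 m p q 0 hk.2 hk'.2 (by simpa using heq)
        rw [this]
      · exfalso
        apply hden₂ r (by omega) p (by simp; omega) m hmr q (by simp; omega)
        rw [div_eq_div_iff (hx r) (hx m)] at heq
        linear_combination heq
  · -- the terms j ≥ 1
    rw [Finset.mul_sum, Finset.mul_sum, Finset.mul_sum]
    have hI : Finset.Icc 1 t = (Finset.range t).image (· + 1) := by
      ext j
      simp only [Finset.mem_Icc, Finset.mem_image, Finset.mem_range]
      constructor
      · intro h; exact ⟨j - 1, by omega, by omega⟩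
      · rintro ⟨i, h, rfl⟩; omega
    rw [hI, Finset.sum_image (by intro i _ j _ h; simpa using h)]
    apply Finset.sum_congr rfl
    intro i hi
    have hjt : i + 1 ≤ t := by simpa using hi
    have hjm : i + 1 ∈ Finset.Icc 1 t := by simp; omega
    generalize i + 1 = j at *
    have hc1 : hcs S (fun k => s * (j : ℂ) * (z - a k.1)⁻¹ +
        - ((k.2 : ℂ) * σ k.1) / (z - a k.1)) t =
        hcs S (fun k => ((j : ℂ) * s - (k.2 : ℂ) * σ k.1) / (z - a k.1)) t :=
      hcs_congr _ _ _ _ (by intro k _; ring)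
    have key : (∏ i, ((z - a i) ^ (n i + 1))⁻¹) *
        hcs S (fun k => ((j : ℂ) * s - (k.2 : ℂ) * σ k.1) / (z - a k.1)) t =
        ∑ r : Fin L,
              (σ r ^ n r * (z - a r) ^ (n r + 1 + t))⁻¹ *
                ∑ p ∈ Finset.range (n r + 1),
                  ((j : ℂ) * s - (p : ℂ) * σ r) ^ ((∑ m, n m) + L - 1 + t) /
                      ((p.factorial : ℂ) * ((n r - p).factorial : ℂ)) * (-1) ^ p *
                    ∏ m ∈ Finset.univ.erase r, ∏ q ∈ Finset.range (n m + 1),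
                      ((z - a m) * ((j : ℂ) * s - (p : ℂ) * σ r) -
                        (z - a r) * ((j : ℂ) * s - (q : ℂ) * σ m))⁻¹ := by
      rw [hcs_divdiff S _ t ?_ (by omega), hcardS]
      · have he : (∑ m, n m) + L + t - 1 = (∑ m, n m) + L - 1 + t := by omega
        rw [he, Finset.mul_sum, Finset.sum_sigma]
        apply Finset.sum_congr rfl
        intro r _
        rw [Finset.mul_sum]
        apply Finset.sum_congr rfl
        intro p hp
        exact term1 n (fun i => z - a i) σ ((j : ℂ) * s) hx hσ r p t
          (by simpa [Nat.lt_succ_iff] using hp) hL _ rfl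
      · rintro ⟨r, p⟩ hk ⟨m, q⟩ hk' heq
        simp [hS] at hk hk'
        simp only at heq
        by_cases hmr : m = r
        · subst hmr
          have := hinj1 m p q _ (by omega) (by omega) heq
          rw [this]
        · exfalso
          apply hden₁ j hjm r p (by omega) m hmr q (by omega)
          rw [div_eq_div_iff (hx r) (hx m)] at heq
          linear_combination heq
    rw [hc1, ← key]
    have hch : (t.choose j : ℂ) = (t.factorial : ℂ) / ((j.factorial : ℂ) * ((t - j).factorial : ℂ)) :=
      Nat.cast_choose ℂ hjt
    rw [hch]
    ring
end

section
/- Let h(z) = ∏_{i=1}^{L} (z - a_i)^{-(n_i+1)} with distinct complex a_i and integers n_i ≥ 0, let t ≥ 0 and N ≥ t+1 be integers, and let s₁,...,s_L, s be parameters with s ≠ 0, s_i = 0 iff n_i = 0, chosen so all denominators below are nonzero. With Θ₁(j,r,p) = (js - p s_r)^{(∑_m n_m)+L-1+t}/(p!(n_r-p)!) · (-1)^p · ∏_{m≠r} ∏_{q=0}^{n_m} 1/((z-a_m)(js - p s_r) - (z-a_r)(js - q s_m)), for every z not a pole of h: h^{(t)}(z) = (t!/s^t)(-1)^{N+t} ∑_{j=1}^{N}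 ( j^{N-t}/(j!(N-j)!) (-1)^j ∑_{r=1}^{L} ( (1/(s_r^{n_r}(z-a_r)^{n_r+1+t})) ∑_{p=0}^{n_r} Θ₁(j,r,p) ) ). -/
/-- geometric series -/
noncomputable def geomPS {R : Type*} [CommRing R] (y : R) : PowerSeries R :=
  PowerSeries.mk (fun k => y ^ k)

lemma geomPS_coeff {R : Type*} [CommRing R] (y : R) (k : ℕ) :
    PowerSeries.coeff k (geomPS y) = y ^ k := by simp [geomPS]

lemma geomPS_mul_one_sub {R : Type*} [CommRing R] (y : R) :
    geomPS y * (1 - PowerSeries.C y * PowerSeries.X) = 1 := by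
  ext k
  cases k with
  | zero => simp [geomPS]
  | succ k =>
    rw [mul_sub, mul_one, ← mul_assoc, map_sub, PowerSeries.coeff_succ_mul_X,
      PowerSeries.coeff_mul_C]
    simp [geomPS, PowerSeries.coeff_one, pow_succ]

lemma geomPS_mul (a b : ℂ) (h : a ≠ b) :
    geomPS a * geomPS b =
      PowerSeries.C (a / (a - b)) * geomPS a + PowerSeries.C (b / (b - a)) * geomPS b := by
  have ha := geomPS_mul_one_sub a
  have hb := geomPS_mul_one_sub b
  have h1 : a - b ≠ 0 := sub_ne_zero.mpr h
  have h2 : b - a ≠ 0 := sub_ne_zero.mpr h.symm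
  have e1 : (PowerSeries.C (a / (a - b)) : PowerSeries ℂ) + PowerSeries.C (b / (b - a)) = 1 := by
    rw [← map_add, ← map_one (PowerSeries.C (R := ℂ))]
    congr 1
    rw [← neg_sub a b]
    rw [div_neg, ← sub_eq_add_neg, ← sub_div, div_self h1]
  have e2 : (PowerSeries.C (a / (a - b)) : PowerSeries ℂ) * PowerSeries.C b
      + PowerSeries.C (b / (b - a)) * PowerSeries.C a = 0 := by
    rw [← map_mul, ← map_mul, ← map_add, ← map_zero (PowerSeries.C (R := ℂ))]
    congr 1
    rw [← neg_sub a b]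
    field_simp
    ring
  generalize (PowerSeries.C (a / (a - b)) : PowerSeries ℂ) = u at *
  generalize (PowerSeries.C (b / (b - a)) : PowerSeries ℂ) = v at *
  generalize (PowerSeries.C a : PowerSeries ℂ) = A at *
  generalize (PowerSeries.C b : PowerSeries ℂ) = B at *
  linear_combination (-(geomPS a * geomPS b)) * e1 + (geomPS a * geomPS b * PowerSeries.X) * e2
    + u * geomPS a * hb + v * geomPS b * ha

lemma nodalWeight_cons {ι : Type*} [DecidableEq ι] (S : Finset ι) (y : ι → ℂ) (a : ι)
    (ha : a ∉ S) (i : ι) (hi : i ∈ S) :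
    Lagrange.nodalWeight (Finset.cons a S ha) y i =
      (y i - y a)⁻¹ * Lagrange.nodalWeight S y i := by
  have hne : a ≠ i := fun h => ha (h ▸ hi)
  unfold Lagrange.nodalWeight
  rw [Finset.cons_eq_insert, Finset.erase_insert_of_ne hne, Finset.prod_insert]
  simp [ha]

lemma prod_geomPS {ι : Type*} [DecidableEq ι] (S : Finset ι) (hS : S.Nonempty) (y : ι → ℂ)
    (hy : Set.InjOn y S) :
    ∏ i ∈ S, geomPS (y i) = ∑ i ∈ S,
      PowerSeries.C (y i ^ (S.card - 1) * Lagrange.nodalWeight S y i) * geomPS (y i) := by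
  induction hS using Finset.Nonempty.cons_induction with
  | singleton a => simp [Lagrange.nodalWeight]
  | cons a S ha hS ih =>
    have hyS : Set.InjOn y S := hy.mono (by simp)
    have hne : ∀ i ∈ S, y a ≠ y i := by
      intro i hi h
      have := hy (by simp) (by simp [hi]) h
      exact ha (this ▸ hi)
    have hcard : S.card - 1 + 1 = S.card := Nat.sub_add_cancel hS.card_pos
    rw [Finset.prod_cons, ih hyS, Finset.mul_sum, Finset.sum_cons, Finset.card_cons,
      Nat.add_sub_cancel]
    have key : ∑ i ∈ S, y i ^ (S.card - 1) * Lagrange.nodalWeight S y i * (y a / (y a - y i))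
        = y a ^ S.card * Lagrange.nodalWeight (Finset.cons a S ha) y a := by
      have h1 := Lagrange.eval_interpolate_not_at_node (s := S) (v := y) (x := y a)
        (fun i => (Polynomial.X ^ (S.card - 1) : Polynomial ℂ).eval (y i)) hne
      rw [← Lagrange.eq_interpolate hyS (by
        rw [Polynomial.degree_X_pow]; exact_mod_cast (by omega))] at h1
      simp only [Polynomial.eval_pow, Polynomial.eval_X] at h1
      have h2 : Lagrange.nodalWeight (Finset.cons a S ha) y a
          = (Polynomial.eval (y a) (Lagrange.nodal S y))⁻¹ := by
        rw [Lagrange.nodalWeight_eq_eval_nodal_erase_inv, Finset.cons_eq_insert,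
          Finset.erase_insert ha]
      have h3 : Polynomial.eval (y a) (Lagrange.nodal S y) ≠ 0 :=
        Lagrange.eval_nodal_not_at_node hne
      rw [h2, ← hcard, pow_succ, hcard, h1]
      field_simp
      rw [Finset.mul_sum]
      refine Finset.sum_congr rfl fun i hi => ?_
      ring
    rw [← key, map_sum, Finset.sum_mul, ← Finset.sum_add_distrib]
    refine Finset.sum_congr rfl fun i hi => ?_
    rw [nodalWeight_cons S y a ha i hi, mul_left_comm, geomPS_mul _ _ (hne i hi), mul_add,
      ← mul_assoc, ← mul_assoc, ← map_mul, ← map_mul]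
    congr 3
    rw [← hcard, pow_succ, hcard]
    ring

lemma coeff_prod_geomPS {ι : Type*} [DecidableEq ι] (S : Finset ι) (hS : S.Nonempty) (y : ι → ℂ)
    (hy : Set.InjOn y S) (t : ℕ) :
    ∑ i ∈ S, y i ^ (S.card - 1 + t) * (∏ k ∈ S.erase i, (y i - y k))⁻¹
      = PowerSeries.coeff t (∏ i ∈ S, geomPS (y i)) := by
  rw [prod_geomPS S hS y hy, map_sum]
  refine Finset.sum_congr rfl fun i hi => ?_
  rw [PowerSeries.coeff_C_mul, geomPS_coeff, Lagrange.nodalWeight, Finset.prod_inv_distrib]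
  ring

lemma finDiff (N : ℕ) (P : Polynomial ℂ) (hP : P.natDegree ≤ N) :
    (-1) ^ N * ∑ j ∈ Finset.range (N + 1),
      (-1) ^ j / ((j.factorial : ℂ) * ((N - j).factorial : ℂ)) * P.eval (j : ℂ) = P.coeff N := by
  have h : (fwdDiff (1:ℂ))^[N] (fun x => P.eval x) 0 = P.coeff N * N.factorial := by
    rcases hP.lt_or_eq with h | h
    · rw [Polynomial.fwdDiff_iter_eq_zero_of_degree_lt h, Polynomial.coeff_eq_zero_of_natDegree_lt h]
      simp
    · rw [← h, Polynomial.fwdDiff_iter_degree_eq_factorial]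
      simp
  rw [fwdDiff_iter_eq_sum_shift] at h
  have hN : (N.factorial : ℂ) ≠ 0 := by exact_mod_cast N.factorial_ne_zero
  apply mul_right_cancel₀ hN
  rw [← h, Finset.mul_sum, Finset.sum_mul]
  refine Finset.sum_congr rfl fun j hj => ?_
  have hj' : j ≤ N := by simpa [Nat.lt_succ_iff] using hj
  have h1 : (N.choose j : ℂ) = N.factorial / (j.factorial * (N - j).factorial) :=
    Nat.cast_choose ℂ hj'
  have h2 : ((-1 : ℂ)) ^ N = (-1) ^ (N - j) * (-1) ^ j := by rw [← pow_add, Nat.sub_add_cancel hj']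
  have h3 : ((-1 : ℂ)) ^ j * (-1) ^ j = 1 := by rw [← mul_pow]; simp
  simp only [zsmul_eq_mul, zero_add, nsmul_eq_mul, mul_one]
  push_cast
  rw [h1, h2]
  linear_combination ((-1) ^ (N - j) * N.factorial / (j.factorial * (N - j).factorial) * P.eval (j : ℂ)) * h3

/-- degree predicate -/
def TopPS (F : PowerSeries (Polynomial ℂ)) (f : PowerSeries ℂ) : Prop :=
  ∀ k, (PowerSeries.coeff k F).natDegree ≤ k ∧
    (PowerSeries.coeff k F).coeff k = PowerSeries.coeff k f

lemma TopPS.mul {F G f g} (h1 : TopPS F f) (h2 : TopPS G g) : TopPS (F * G) (f * g) := by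
  intro k
  rw [PowerSeries.coeff_mul, PowerSeries.coeff_mul]
  constructor
  · refine Polynomial.natDegree_sum_le_of_forall_le _ _ fun p hp => ?_
    rw [← Finset.HasAntidiagonal.mem_antidiagonal.mp hp]
    exact Polynomial.natDegree_mul_le_of_le (h1 _).1 (h2 _).1
  · rw [Polynomial.finsetSum_coeff]
    refine Finset.sum_congr rfl fun p hp => ?_
    rw [← Finset.HasAntidiagonal.mem_antidiagonal.mp hp,
      Polynomial.coeff_mul_add_eq_of_natDegree_le (h1 _).1 (h2 _).1, (h1 _).2, (h2 _).2]

lemma TopPS.one : TopPS 1 1 := by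
  intro k
  simp only [PowerSeries.coeff_one]
  by_cases h : k = 0
  · simp [h]
  · simp [h]

lemma TopPS.prod {ι : Type*} (S : Finset ι) (F : ι → PowerSeries (Polynomial ℂ))
    (f : ι → PowerSeries ℂ) (h : ∀ i, TopPS (F i) (f i)) :
    TopPS (∏ i ∈ S, F i) (∏ i ∈ S, f i) := by
  classical
  induction S using Finset.induction_on with
  | empty => simpa using TopPS.one
  | insert a S ha ih => rw [Finset.prod_insert ha, Finset.prod_insert ha]; exact (h a).mul ih

lemma TopPS.geom (u v : ℂ) :
    TopPS (geomPS (Polynomial.C u * Polynomial.X + Polynomial.C v)) (geomPS u) := by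
  intro k
  rw [geomPS_coeff, geomPS_coeff]
  have h : (Polynomial.C u * Polynomial.X + Polynomial.C v).natDegree ≤ 1 :=
    Polynomial.natDegree_linear_le
  constructor
  · simpa using Polynomial.natDegree_pow_le_of_le k h
  · have := Polynomial.coeff_pow_of_natDegree_le (m := k) h
    simpa using this

lemma map_geomPS {R T : Type*} [CommRing R] [CommRing T] (φ : R →+* T) (y : R) :
    PowerSeries.map φ (geomPS y) = geomPS (φ y) := by
  ext k
  simp [geomPS_coeff]

/-- derivative predicate -/
def DerPS (z : ℂ) (f : ℂ → ℂ) (F : PowerSeries ℂ) : Prop :=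
  (∀ k : ℕ, ContDiffAt ℂ k f z) ∧
    ∀ k : ℕ, iteratedDeriv k f z = (-1) ^ k * k.factorial * f z * PowerSeries.coeff k F

lemma DerPS.mul {z f g F G} (h1 : DerPS z f F) (h2 : DerPS z g G) : DerPS z (f * g) (F * G) := by
  refine ⟨fun k => (h1.1 k).mul (h2.1 k), fun k => ?_⟩
  rw [iteratedDeriv_mul (h1.1 k) (h2.1 k), PowerSeries.coeff_mul,
    Finset.Nat.sum_antidiagonal_eq_sum_range_succ
      (fun i j => PowerSeries.coeff i F * PowerSeries.coeff j G), Finset.mul_sum]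
  refine Finset.sum_congr rfl fun j hj => ?_
  have hj' : j ≤ k := by simpa [Nat.lt_succ_iff] using hj
  rw [h1.2, h2.2, Pi.mul_apply]
  have e1 : ((-1 : ℂ)) ^ k = (-1) ^ j * (-1) ^ (k - j) := by rw [← pow_add, Nat.add_sub_cancel' hj']
  have e2 : (k.factorial : ℂ) = k.choose j * j.factorial * (k - j).factorial := by
    exact_mod_cast (Nat.choose_mul_factorial_mul_factorial hj').symm
  rw [e1, e2]
  ring

lemma DerPS.one (z : ℂ) : DerPS z 1 1 := by
  refine ⟨fun k => contDiffAt_const, fun k => ?_⟩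
  have : (1 : ℂ → ℂ) = fun _ => 1 := rfl
  rw [this, iteratedDeriv_const, PowerSeries.coeff_one]
  by_cases h : k = 0 <;> simp [h]

lemma DerPS.prod {ι : Type*} (S : Finset ι) {z : ℂ} (f : ι → ℂ → ℂ)
    (F : ι → PowerSeries ℂ) (h : ∀ i, DerPS z (f i) (F i)) :
    DerPS z (∏ i ∈ S, f i) (∏ i ∈ S, F i) := by
  classical
  induction S using Finset.induction_on with
  | empty => simpa using DerPS.one z
  | insert a S ha ih => rw [Finset.prod_insert ha, Finset.prod_insert ha]; exact (h a).mul ih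

lemma DerPS.inv (z a : ℂ) (h : z ≠ a) : DerPS z (fun w => (w - a)⁻¹) (geomPS (z - a)⁻¹) := by
  have h' : z - a ≠ 0 := sub_ne_zero.mpr h
  refine ⟨fun k => (contDiffAt_id.sub contDiffAt_const).inv h', fun k => ?_⟩
  have := congrFun (iter_deriv_inv_linear_sub k (1:ℂ) a) z
  simp only [one_mul] at this
  rw [iteratedDeriv_eq_iterate, this, geomPS_coeff, zpow_sub₀ h']
  simp
  ring

lemma prod_range_erase (n p : ℕ) (hp : p ≤ n) :
    ∏ q ∈ (Finset.range (n + 1)).erase p, ((q : ℂ) - p)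
      = (-1) ^ p * (p.factorial * (n - p).factorial) := by
  induction n with
  | zero => obtain rfl : p = 0 := by omega
            simp
  | succ n ih =>
    rcases hp.lt_or_eq with h | h
    · rw [Finset.range_add_one, Finset.erase_insert_of_ne (by omega), Finset.prod_insert (by simp),
        ih (by omega), Nat.sub_add_comm (by omega), Nat.factorial_succ]
      push_cast [Nat.cast_sub (show p ≤ n by omega)]
      ring
    · subst h
      rw [Finset.range_add_one, Finset.erase_insert (by simp), ← Finset.prod_range_reflect,
        ← Finset.prod_range_add_one_eq_factorial]
      simp only [Nat.sub_self, Nat.factorial_zero]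
      push_cast
      rw [mul_one, ← Finset.card_range (n + 1), ← Finset.prod_const, Finset.card_range,
        ← Finset.prod_mul_distrib]
      refine Finset.prod_congr rfl fun j hj => ?_
      have : j ≤ n := by simpa [Nat.lt_succ_iff] using hj
      rw [Nat.cast_sub this]
      ring

lemma geomPS_smul (c u : ℂ) : geomPS (c * u) = PowerSeries.rescale c (geomPS u) := by
  ext k
  simp [geomPS_coeff, PowerSeries.coeff_rescale, mul_pow]

lemma theta_inner_sum (L : ℕ) (hL : 1 ≤ L) (a : Fin L → ℂ)
    (n : Fin L → ℕ) (t : ℕ)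
    (σ : Fin L → ℂ) (hσ : ∀ i, σ i = 0 ↔ n i = 0)
    (z x : ℂ) (hz : ∀ i, z ≠ a i)
    (hden : ∀ r : Fin L, ∀ p ≤ n r, ∀ m : Fin L, m ≠ r → ∀ q ≤ n m,
      (z - a m) * (x - (p : ℂ) * σ r) - (z - a r) * (x - (q : ℂ) * σ m) ≠ 0) :
    ∑ r : Fin L, (σ r ^ n r * (z - a r) ^ (n r + 1 + t))⁻¹ *
      ∑ p ∈ Finset.range (n r + 1),
        (x - (p : ℂ) * σ r) ^ ((∑ m, n m) + L - 1 + t) /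
            ((p.factorial : ℂ) * ((n r - p).factorial : ℂ)) * (-1) ^ p *
          ∏ m ∈ Finset.univ.erase r, ∏ q ∈ Finset.range (n m + 1),
            ((z - a m) * (x - (p : ℂ) * σ r) - (z - a r) * (x - (q : ℂ) * σ m))⁻¹
    = (∏ i, ((z - a i) ^ (n i + 1))⁻¹) *
      PowerSeries.coeff t (∏ i ∈ (Finset.univ : Finset (Fin L)).sigma
        (fun r => Finset.range (n r + 1)), geomPS ((x - (i.2 : ℂ) * σ i.1) / (z - a i.1))) := by
  have hz' : ∀ i, z - a i ≠ 0 := fun i => sub_ne_zero.mpr (hz i)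
  set S := (Finset.univ : Finset (Fin L)).sigma (fun r => Finset.range (n r + 1)) with hSdef
  have hS : S.Nonempty := ⟨⟨⟨0, hL⟩, 0⟩, by simp [hSdef]⟩
  have hcard : S.card = (∑ m, n m) + L := by
    simp [hSdef, Finset.card_sigma, Finset.sum_add_distrib]
  have hdiff : ∀ r p m q, (x - (p : ℂ) * σ r) / (z - a r) - (x - (q : ℂ) * σ m) / (z - a m)
      = ((z - a m) * (x - (p : ℂ) * σ r) - (z - a r) * (x - (q : ℂ) * σ m))
        / ((z - a m) * (z - a r)) := by
    intro r p m q
    rw [div_sub_div _ _ (hz' r) (hz' m)]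
    ring
  have hinj : Set.InjOn (fun i : (Σ _ : Fin L, ℕ) => (x - (i.2 : ℂ) * σ i.1) / (z - a i.1)) S := by
    rintro ⟨r, p⟩ h1 ⟨m, q⟩ h2 h
    simp only [hSdef, Finset.coe_sigma, Set.mem_sigma_iff, Finset.mem_coe, Finset.mem_range,
      Finset.mem_univ, true_and, Nat.lt_succ_iff] at h1 h2
    by_cases hmr : m = r
    · subst hmr
      simp only [div_left_inj' (hz' m), sub_right_inj] at h
      rcases eq_or_ne (n m) 0 with h0 | h0
      · obtain rfl : p = 0 := by omega
        obtain rfl : q = 0 := by omega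
        rfl
      · have : σ m ≠ 0 := fun e => h0 ((hσ m).mp e)
        have := mul_right_cancel₀ this h
        have : p = q := by exact_mod_cast this
        rw [this]
    · exfalso
      have h' := sub_eq_zero.mpr h
      simp only at h'
      rw [hdiff, div_eq_zero_iff] at h'
      rcases h' with h' | h'
      · exact hden r p h1 m hmr q h2 h'
      · exact mul_ne_zero (hz' m) (hz' r) h'
  rw [← coeff_prod_geomPS S hS _ hinj t, hcard, hSdef, Finset.sum_sigma, Finset.mul_sum]
  refine Finset.sum_congr rfl fun r _ => ?_
  rw [Finset.mul_sum, Finset.mul_sum]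
  refine Finset.sum_congr rfl fun p hp => ?_
  have hpn : p ≤ n r := by simpa [Nat.lt_succ_iff] using hp
  rw [← hSdef]
  have hErase : S.erase ⟨r, p⟩ =
      ((Finset.range (n r + 1)).erase p).map (Function.Embedding.sigmaMk r) ∪
      (Finset.univ.erase r).sigma (fun r => Finset.range (n r + 1)) := by
    ext ⟨m, q⟩
    simp only [hSdef, Finset.mem_erase, Finset.mem_union, Finset.mem_map, Finset.mem_sigma,
      Finset.mem_univ, true_and, Function.Embedding.sigmaMk_apply, Sigma.mk.injEq, ne_eq]
    by_cases hmr : m = r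
    · subst hmr
      simp
    · simp [hmr, Ne.symm hmr]
  have hdisj : Disjoint (((Finset.range (n r + 1)).erase p).map (Function.Embedding.sigmaMk r))
      ((Finset.univ.erase r).sigma (fun r => Finset.range (n r + 1))) := by
    rw [Finset.disjoint_left]
    rintro ⟨m, q⟩ h1 h2
    simp only [Finset.mem_map, Finset.mem_sigma, Finset.mem_erase,
      Function.Embedding.sigmaMk_apply, Sigma.mk.injEq] at h1 h2
    obtain ⟨_, _, h, _⟩ := h1
    exact h2.1.1 h.symm
  rw [hErase, Finset.prod_union hdisj, Finset.prod_map, Finset.prod_sigma]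
  simp only [Function.Embedding.sigmaMk_apply]
  have hp1 : ∏ q ∈ (Finset.range (n r + 1)).erase p,
      ((x - (p : ℂ) * σ r) / (z - a r) - (x - (q : ℂ) * σ r) / (z - a r))
      = (σ r / (z - a r)) ^ n r * ((-1) ^ p * (p.factorial * (n r - p).factorial)) := by
    rw [← prod_range_erase (n r) p hpn]
    have hc : ((Finset.range (n r + 1)).erase p).card = n r := by
      rw [Finset.card_erase_of_mem hp]; simp
    have hpow : (σ r / (z - a r)) ^ n r
        = ∏ _q ∈ (Finset.range (n r + 1)).erase p, (σ r / (z - a r)) := by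
      rw [Finset.prod_const, hc]
    rw [hpow, ← Finset.prod_mul_distrib]
    refine Finset.prod_congr rfl fun q _ => ?_
    ring
  have hp2 : ∏ m ∈ Finset.univ.erase r, ∏ q ∈ Finset.range (n m + 1),
      ((x - (p : ℂ) * σ r) / (z - a r) - (x - (q : ℂ) * σ m) / (z - a m))
      = (∏ m ∈ Finset.univ.erase r, ∏ q ∈ Finset.range (n m + 1),
          ((z - a m) * (x - (p : ℂ) * σ r) - (z - a r) * (x - (q : ℂ) * σ m))) /
        ((∏ m ∈ Finset.univ.erase r, (z - a m) ^ (n m + 1)) *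
          (z - a r) ^ (∑ m ∈ Finset.univ.erase r, (n m + 1))) := by
    rw [← Finset.prod_pow_eq_pow_sum, ← Finset.prod_mul_distrib, ← Finset.prod_div_distrib]
    refine Finset.prod_congr rfl fun m _ => ?_
    rw [← mul_pow, ← Finset.card_range (n m + 1), ← Finset.prod_const, Finset.card_range,
      ← Finset.prod_div_distrib]
    exact Finset.prod_congr rfl fun q _ => hdiff r p m q
  have hp3 : ∏ i, ((z - a i) ^ (n i + 1))⁻¹ =
      ((z - a r) ^ (n r + 1))⁻¹ * (∏ m ∈ Finset.univ.erase r, (z - a m) ^ (n m + 1))⁻¹ := by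
    rw [← Finset.mul_prod_erase _ _ (Finset.mem_univ r), Finset.prod_inv_distrib]
  have hM : (∑ m, n m) + L = (n r + 1) + ∑ m ∈ Finset.univ.erase r, (n m + 1) := by
    rw [Finset.add_sum_erase _ (fun m => n m + 1) (Finset.mem_univ r)]
    simp [Finset.sum_add_distrib]
  rw [hp1, hp2, hp3, hM]
  simp only [Finset.prod_inv_distrib]
  have hA : ∏ m ∈ Finset.univ.erase r, (z - a m) ^ (n m + 1) ≠ 0 :=
    Finset.prod_ne_zero_iff.mpr fun m _ => pow_ne_zero _ (hz' m)
  have hB : ∏ m ∈ Finset.univ.erase r, ∏ q ∈ Finset.range (n m + 1),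
          ((z - a m) * (x - (p : ℂ) * σ r) - (z - a r) * (x - (q : ℂ) * σ m)) ≠ 0 :=
    Finset.prod_ne_zero_iff.mpr fun m hm => Finset.prod_ne_zero_iff.mpr fun q hq =>
      hden r p hpn m (Finset.ne_of_mem_erase hm) q (by simpa [Nat.lt_succ_iff] using hq)
  generalize ∏ m ∈ Finset.univ.erase r, (z - a m) ^ (n m + 1) = A at *
  generalize ∏ m ∈ Finset.univ.erase r, ∏ q ∈ Finset.range (n m + 1),
          ((z - a m) * (x - (p : ℂ) * σ r) - (z - a r) * (x - (q : ℂ) * σ m)) = B at *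
  generalize ∑ m ∈ Finset.univ.erase r, (n m + 1) = E
  have hσn : σ r ^ n r ≠ 0 := by
    rcases eq_or_ne (n r) 0 with h0 | h0
    · simp [h0]
    · exact pow_ne_zero _ fun e => h0 ((hσ r).mp e)
  have f1 : (p.factorial : ℂ) ≠ 0 := by exact_mod_cast p.factorial_ne_zero
  have f2 : ((n r - p).factorial : ℂ) ≠ 0 := by exact_mod_cast (n r - p).factorial_ne_zero
  have hs1 : ((-1 : ℂ)) ^ p * (-1) ^ p = 1 := by rw [← mul_pow]; simp
  have hs2 : (((-1 : ℂ)) ^ p)⁻¹ = (-1) ^ p := inv_eq_of_mul_eq_one_left hs1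
  have hzr := hz' r
  rw [show n r + 1 + E - 1 + t = n r + E + t by omega]
  simp only [mul_inv, div_eq_mul_inv, mul_pow, inv_pow, inv_inv, hs2]
  generalize (x - (p : ℂ) * σ r) ^ (n r + E + t) = Y
  generalize ((-1 : ℂ)) ^ p = e
  generalize σ r ^ n r = w at *
  generalize z - a r = u at *
  field_simp
  ring

/-- Formula (6) of Theorem 3.1: explicit formula for the `t`-th derivative of
`h(z) = ∏ (z - aᵢ)^{-(nᵢ+1)}`, valid for every integer `N ≥ t + 1` and any choice of
nonzero-denominator parameters `s`, `σᵢ` with `s ≠ 0` and `σᵢ = 0 ↔ nᵢ = 0`. -/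
theorem stmt_16 (L : ℕ) (hL : 1 ≤ L) (a : Fin L → ℂ) (ha : Function.Injective a)
    (n : Fin L → ℕ) (t N : ℕ) (hN : t + 1 ≤ N)
    (σ : Fin L → ℂ) (s : ℂ) (hs : s ≠ 0) (hσ : ∀ i, σ i = 0 ↔ n i = 0)
    (z : ℂ) (hz : ∀ i, z ≠ a i)
    (hden : ∀ j ∈ Finset.Icc 1 N, ∀ r : Fin L, ∀ p ≤ n r, ∀ m : Fin L, m ≠ r → ∀ q ≤ n m,
      (z - a m) * ((j : ℂ) * s - (p : ℂ) * σ r) -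
        (z - a r) * ((j : ℂ) * s - (q : ℂ) * σ m) ≠ 0) :
    iteratedDeriv t (fun w : ℂ => ∏ i, ((w - a i) ^ (n i + 1))⁻¹) z =
      (t.factorial : ℂ) / s ^ t * (-1) ^ (N + t) *
        ∑ j ∈ Finset.Icc 1 N,
          (j : ℂ) ^ (N - t) / ((j.factorial : ℂ) * ((N - j).factorial : ℂ)) * (-1) ^ j *
            ∑ r : Fin L,
              (σ r ^ n r * (z - a r) ^ (n r + 1 + t))⁻¹ *
                ∑ p ∈ Finset.range (n r + 1),
                  ((j : ℂ) * s - (p : ℂ) * σ r) ^ ((∑ m, n m) + L - 1 + t) /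
                      ((p.factorial : ℂ) * ((n r - p).factorial : ℂ)) * (-1) ^ p *
                    ∏ m ∈ Finset.univ.erase r, ∏ q ∈ Finset.range (n m + 1),
                      ((z - a m) * ((j : ℂ) * s - (p : ℂ) * σ r) -
                        (z - a r) * ((j : ℂ) * s - (q : ℂ) * σ m))⁻¹ := by
  
  classical
  set S := (Finset.univ : Finset (Fin L)).sigma (fun r => Finset.range (n r + 1)) with hSdef
  have hprod : (fun w : ℂ => ∏ i, ((w - a i) ^ (n i + 1))⁻¹)
      = ∏ i ∈ S, (fun w : ℂ => (w - a i.1)⁻¹) := by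
    funext w
    rw [Finset.prod_apply, hSdef, Finset.prod_sigma]
    refine Finset.prod_congr rfl fun i _ => ?_
    simp
  have hD := DerPS.prod S (z := z) (fun i => fun w : ℂ => (w - a i.1)⁻¹)
    (fun i => geomPS (z - a i.1)⁻¹) (fun i => DerPS.inv z _ (hz i.1))
  rw [← hprod] at hD
  rw [hD.2 t]
  set K := PowerSeries.coeff t (∏ i ∈ S, geomPS (z - a i.1)⁻¹) with hK
  set H := ∏ i, ((z - a i) ^ (n i + 1))⁻¹ with hH
  have hT := TopPS.prod S
    (fun i => geomPS (Polynomial.C (s * (z - a i.1)⁻¹) * Polynomial.X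
      + Polynomial.C (-((i.2 : ℂ) * σ i.1) / (z - a i.1))))
    (fun i => geomPS (s * (z - a i.1)⁻¹)) (fun i => TopPS.geom _ _) t
  set Q := PowerSeries.coeff t (∏ i ∈ S,
    geomPS (Polynomial.C (s * (z - a i.1)⁻¹) * Polynomial.X
      + Polynomial.C (-((i.2 : ℂ) * σ i.1) / (z - a i.1)))) with hQ
  have hQc : Q.coeff t = s ^ t * K := by
    rw [hT.2]
    simp only [geomPS_smul]
    rw [← map_prod, PowerSeries.coeff_rescale]
  have hQe : ∀ x : ℂ, Q.eval x =
      PowerSeries.coeff t (∏ i ∈ S, geomPS ((x * s - (i.2 : ℂ) * σ i.1) / (z - a i.1))) := by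
    intro x
    rw [← Polynomial.coe_evalRingHom, hQ, ← PowerSeries.coeff_map, map_prod]
    congr 1
    refine Finset.prod_congr rfl fun i _ => ?_
    rw [map_geomPS]
    congr 1
    simp
    ring
  have hFD := finDiff N (Polynomial.X ^ (N - t) * Q) (by
    refine (Polynomial.natDegree_mul_le_of_le (Polynomial.natDegree_X_pow_le _) hT.1).trans ?_
    omega)
  have hc : (Polynomial.X ^ (N - t) * Q).coeff N = s ^ t * K := by
    rw [← hQc, Polynomial.coeff_X_pow_mul', if_pos (by omega)]
    congr 1
    omega
  rw [hc, Finset.range_eq_Ico, Finset.sum_eq_sum_Ico_succ_bot (by omega)] at hFD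
  have hst : s ^ t ≠ 0 := pow_ne_zero _ hs
  have hK' : K = (s ^ t)⁻¹ * (s ^ t * K) := by field_simp
  have h0 : (0 : ℂ) ^ (N - t) = 0 := zero_pow (by omega)
  rw [hK', ← hFD]
  simp only [Polynomial.eval_mul, Polynomial.eval_pow, Polynomial.eval_X, Nat.cast_zero, h0,
    zero_mul, mul_zero, zero_add]
  have hI : Finset.Ico 1 (N + 1) = Finset.Icc 1 N := by ext; simp [Nat.lt_succ_iff]
  rw [hI]
  simp only [Finset.mul_sum (Finset.Icc 1 N)]
  refine Finset.sum_congr rfl fun j hj => ?_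
  rw [theta_inner_sum L hL a n t σ hσ z ((j : ℂ) * s) hz (hden j hj), hQe]
  rw [pow_add]
  ring
end
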